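/- For every integer r ≥ 1 there exists a real constant c_r > 0 such that the number of connected simple graphs on the labeled vertex set {1,…,n} having exactly n + r edges and all vertex degrees in {2,3} is asymptotically c_r · n! · n^{3r−1} / (3r−1)! as n → ∞. -/

import Mathlib

open Filter

/-- The degree of a vertex `v` in a simple graph `G`, as the number of its neighbors. -/
noncomputable def vdeg {V : Type*} (G : SimpleGraph V) (v : V) : ℕ :=
  (G.neighborSet v).ncard

/-- The number of connected simple graphs on `{1,…,n}` with exactly `n + r` edges and
all vertex degrees in `{2, 3}`. -/
noncomputable def Nconn (r n : ℕ) : ℕ :=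
  Nat.card {G : SimpleGraph (Fin n) //
    G.Connected ∧ G.edgeSet.ncard = n + r ∧
    ∀ v : Fin n, vdeg G v = 2 ∨ vdeg G v = 3}

theorem SimpleGraph.Connected.of_forall_adj_reachable {V W : Type*} {G : SimpleGraph V}
    {H : SimpleGraph W} (hG : G.Connected) (f : V → W)
    (hf : ∀ a b, G.Adj a b → H.Reachable (f a) (f b))
    (hs : ∀ w, ∃ v, H.Reachable w (f v)) : H.Connected := by
  have key : ∀ a b, H.Reachable (f a) (f b) := by
    intro a b
    obtain ⟨w⟩ := hG.preconnected a b
    induction w with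
    | nil => rfl
    | cons h _ ih => exact (hf _ _ h).trans ih
  have := hG.nonempty
  have : Nonempty W := this.map f
  refine ⟨fun a b => ?_⟩
  obtain ⟨a', ha⟩ := hs a
  obtain ⟨b', hb⟩ := hs b
  exact (ha.trans (key a' b')).trans hb.symm

/-- Connected graphs with degrees in `{1, 2, 3}`, `p` vertices of degree one and `q` vertices of
degree three. -/
def connDegSet (V : Type*) (p q : ℕ) : Set (SimpleGraph V) :=
  {G | G.Connected ∧ (∀ v, vdeg G v = 1 ∨ vdeg G v = 2 ∨ vdeg G v = 3) ∧
    {v | vdeg G v = 1}.ncard = p ∧ {v | vdeg G v = 3}.ncard = q}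

theorem ncard_prod_of_fst {α β : Type*} [Finite α] [Finite β] (S : Set (α × β)) (T : Set α) (c : ℕ)
    (hT : ∀ z ∈ S, z.1 ∈ T) (hc : ∀ a ∈ T, {b | (a, b) ∈ S}.ncard = c) :
    S.ncard = T.ncard * c := by
  classical
  have := Fintype.ofFinite α
  have := Fintype.ofFinite β
  rw [Set.ncard_eq_toFinset_card', Set.ncard_eq_toFinset_card',
    Finset.card_eq_sum_card_fiberwise (f := Prod.fst) (t := T.toFinset)
      (fun z hz => by simpa using hT z (by simpa using hz)), Finset.sum_const_nat]
  intro a ha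
  rw [← hc a (by simpa using ha), Set.ncard_eq_toFinset_card',
    ← Finset.card_image_of_injective {b | (a, b) ∈ S}.toFinset (Prod.mk_right_injective a)]
  congr 1
  ext ⟨x, y⟩
  simp only [Finset.mem_filter, Set.mem_toFinset, Finset.mem_image, Set.mem_ofPred_eq, Prod.mk.injEq]
  constructor
  · rintro ⟨h, rfl⟩; exact ⟨y, h, rfl, rfl⟩
  · rintro ⟨_, h, rfl, rfl⟩; exact ⟨h, rfl⟩

theorem ncard_prod_of_snd {α β : Type*} [Finite α] [Finite β] (S : Set (α × β)) (c : ℕ)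
    (hc : ∀ b, {a | (a, b) ∈ S}.ncard = c) :
    S.ncard = Nat.card β * c := by
  have h : (Prod.swap ⁻¹' S).ncard = S.ncard :=
    Set.ncard_preimage_of_injective_subset_range Prod.swap_injective
      (by rw [Prod.swap_surjective.range_eq]; exact Set.subset_univ _)
  rw [← h, ← Set.ncard_univ β]
  exact ncard_prod_of_fst _ Set.univ c (by simp) fun b _ => hc b

theorem vdeg_iso {V W : Type*} {G : SimpleGraph V} {H : SimpleGraph W} (f : G ≃g H) (v : V) :
    vdeg H (f v) = vdeg G v :=
  (Set.ncard_congr' (f.mapNeighborSet v)).symm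

theorem mem_connDegSet_iso {V W : Type*} {G : SimpleGraph V} {H : SimpleGraph W} (f : G ≃g H) {p q : ℕ} :
    G ∈ connDegSet V p q ↔ H ∈ connDegSet W p q := by
  have h : ∀ k, {v | vdeg H v = k}.ncard = {v | vdeg G v = k}.ncard := by
    intro k
    refine (Set.ncard_congr' (Equiv.subtypeEquiv f.toEquiv fun v => ?_)).symm
    simp [← vdeg_iso f v]
  have h2 : (∀ v, vdeg H v = 1 ∨ vdeg H v = 2 ∨ vdeg H v = 3) ↔
      (∀ v, vdeg G v = 1 ∨ vdeg G v = 2 ∨ vdeg G v = 3) := by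
    rw [← f.toEquiv.forall_congr_right]
    simp [vdeg_iso f]
  simp only [connDegSet, Set.mem_ofPred_eq, h, h2, f.connected_iff]

theorem sum_vdeg {V : Type*} [Fintype V] (G : SimpleGraph V) : ∑ v, vdeg G v = 2 * G.edgeSet.ncard := by
  classical
  rw [Set.ncard_eq_toFinset_card', ← SimpleGraph.edgeFinset,
    ← SimpleGraph.sum_degrees_eq_twice_card_edges]
  refine Finset.sum_congr rfl fun v _ => ?_
  rw [vdeg, Set.ncard_eq_toFinset_card', ← SimpleGraph.neighborFinset,
    SimpleGraph.card_neighborFinset_eq_degree]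

/-- The degree-count bookkeeping for a function with values in `{1, 2, 3}`. -/
theorem card_and_sum_of_values {V : Type*} [Fintype V] (d : V → ℕ) (hd : ∀ v, d v = 1 ∨ d v = 2 ∨ d v = 3) :
    {v | d v = 1}.ncard + {v | d v = 2}.ncard + {v | d v = 3}.ncard = Nat.card V ∧
    ∑ v, d v = {v | d v = 1}.ncard + 2 * {v | d v = 2}.ncard + 3 * {v | d v = 3}.ncard := by
  classical
  have e : ∀ k, {v | d v = k}.ncard = ∑ v, if d v = k then 1 else 0 := by
    intro k
    rw [Set.ncard_eq_toFinset_card', Finset.sum_boole]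
    simp
  simp only [e, Finset.mul_sum, ← Finset.sum_add_distrib, Nat.card_eq_fintype_card,
    Fintype.card_eq_sum_ones]
  constructor <;> refine Finset.sum_congr rfl fun v _ => ?_ <;>
    rcases hd v with h | h | h <;> simp [h]

theorem ncard_vdeg_two {V : Type*} [Finite V] {p q : ℕ} {G : SimpleGraph V} (hG : G ∈ connDegSet V p q) :
    {v | vdeg G v = 2}.ncard + p + q = Nat.card V := by
  have := Fintype.ofFinite V
  obtain ⟨-, h, rfl, rfl⟩ := hG
  have := (card_and_sum_of_values _ h).1
  lia

theorem two_mul_ncard_edgeSet {V : Type*} [Finite V] {p q : ℕ} {G : SimpleGraph V} (hG : G ∈ connDegSet V p q) :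
    2 * G.edgeSet.ncard + p = 2 * Nat.card V + q := by
  have := Fintype.ofFinite V
  obtain ⟨-, h, rfl, rfl⟩ := hG
  have h1 := (card_and_sum_of_values _ h)
  have := sum_vdeg G
  lia

/-- Subdivide the edge `e` of `G` by a new vertex `none`. -/
def subdivide {W : Type*} (G : SimpleGraph W) (e : Sym2 W) :
    SimpleGraph (Option W) where
  Adj x y := match x, y with
    | none, none => False
    | none, some a => a ∈ e
    | some a, none => a ∈ e
    | some a, some b => G.Adj a b ∧ s(a, b) ≠ e
  symm := ⟨fun x y h => by
    rcases x with _ | x <;> rcases y with _ | y <;> simp_all [G.adj_comm, Sym2.eq_swap]⟩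
  loopless := ⟨fun x h => by rcases x with _ | x <;> simp_all⟩

theorem vdeg_subdivide_none {W : Type*} (G : SimpleGraph W) (e : Sym2 W) (he : e ∈ G.edgeSet) :
    vdeg (subdivide G e) none = 2 := by
  induction e with | _ a b
  have hab : G.Adj a b := he
  have : (subdivide G s(a, b)).neighborSet none = {some a, some b} := by
    ext (_ | x) <;> simp [subdivide]
  rw [vdeg, this, Set.ncard_pair (by simpa using hab.ne)]

theorem vdeg_subdivide_some {W : Type*} (G : SimpleGraph W) (e : Sym2 W) (he : e ∈ G.edgeSet)
    (w : W) : vdeg (subdivide G e) (some w) = vdeg G w := by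
  classical
  have : (subdivide G e).neighborSet (some w) =
      (fun y => if s(w, y) = e then none else some y) '' G.neighborSet w := by
    ext (_ | x)
    · simp only [SimpleGraph.mem_neighborSet, subdivide, Set.mem_image]
      constructor
      · rintro ⟨y, rfl⟩
        exact ⟨y, he, by simp⟩
      · rintro ⟨y, hy, h⟩
        by_cases h' : s(w, y) = e
        · simp [← h']
        · simp [h'] at h
    · simp only [SimpleGraph.mem_neighborSet, subdivide, Set.mem_image]
      constructor
      · rintro ⟨h1, h2⟩
        exact ⟨x, h1, by simp [h2]⟩
      · rintro ⟨y, hy, h⟩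
        by_cases h' : s(w, y) = e
        · simp [h'] at h
        · simp only [h', if_false, Option.some.injEq] at h
          subst h
          exact ⟨hy, h'⟩
  rw [vdeg, vdeg, this, Set.InjOn.ncard_image]
  intro y hy z hz h
  by_cases h1 : s(w, y) = e <;> by_cases h2 : s(w, z) = e <;> simp_all
  exact Sym2.congr_right.1 (h1.trans h2.symm)

theorem connected_subdivide {W : Type*} (G : SimpleGraph W) (e : Sym2 W) (he : e ∈ G.edgeSet) :
    (subdivide G e).Connected ↔ G.Connected := by
  induction e with | _ a b
  have hab : G.Adj a b := he
  have ha : (subdivide G s(a, b)).Adj none (some a) := by simp [subdivide]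
  have hb : (subdivide G s(a, b)).Adj none (some b) := by simp [subdivide]
  constructor
  · intro h
    refine h.of_forall_adj_reachable (fun x => x.getD a) ?_ (fun w => ⟨some w, by rfl⟩)
    rintro (_ | x) (_ | y) h
    · rfl
    · simp only [subdivide, Sym2.mem_iff] at h
      rcases h with rfl | rfl
      · rfl
      · exact hab.reachable
    · simp only [subdivide, Sym2.mem_iff] at h
      rcases h with rfl | rfl
      · rfl
      · exact hab.symm.reachable
    · exact SimpleGraph.Adj.reachable h.1
  · intro h
    refine h.of_forall_adj_reachable some ?_ ?_
    · intro x y hxy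
      by_cases hs : s(x, y) = s(a, b)
      · rw [Sym2.eq_iff] at hs
        rcases hs with ⟨rfl, rfl⟩ | ⟨rfl, rfl⟩
        · exact ha.symm.reachable.trans hb.reachable
        · exact hb.symm.reachable.trans ha.reachable
      · exact SimpleGraph.Adj.reachable (show (subdivide G s(a, b)).Adj _ _ from ⟨hxy, hs⟩)
    · rintro (_ | w)
      · exact ⟨a, ha.reachable⟩
      · exact ⟨w, by rfl⟩

theorem subdivide_mem_connDegSet {W : Type*} [Finite W] (G : SimpleGraph W) (e : Sym2 W)
    (he : e ∈ G.edgeSet) {p q : ℕ} :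
    subdivide G e ∈ connDegSet (Option W) p q ↔ G ∈ connDegSet W p q := by
  have h : ∀ k, k ≠ 2 → {v | vdeg (subdivide G e) v = k}.ncard = {v | vdeg G v = k}.ncard := by
    intro k hk
    rw [← Set.ncard_image_of_injective _ (Option.some_injective W)]
    congr 1
    ext (_ | w)
    · simp [vdeg_subdivide_none _ _ he, hk.symm]
    · simp [vdeg_subdivide_some _ _ he]
  simp [connDegSet, h, connected_subdivide _ _ he, Option.forall, vdeg_subdivide_none _ _ he,
    vdeg_subdivide_some _ _ he]

theorem exists_eq_subdivide {W : Type*} (G : SimpleGraph (Option W)) (h2 : vdeg G none = 2)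
    (hna : ∀ u v, G.Adj none u → G.Adj none v → ¬ G.Adj u v) :
    ∃ (H : SimpleGraph W) (e : Sym2 W) (_ : e ∈ H.edgeSet), subdivide H e = G := by
  obtain ⟨x, y, hxy, hN⟩ := Set.ncard_eq_two.1 h2
  have hadj : ∀ z, G.Adj none z ↔ z = x ∨ z = y := fun z => by
    rw [← SimpleGraph.mem_neighborSet, hN]; simp
  obtain ⟨a, rfl⟩ : ∃ a, x = some a := by
    rcases x with _ | a
    · exact absurd ((hadj none).2 (by simp)) G.irrefl
    · exact ⟨a, rfl⟩
  obtain ⟨b, rfl⟩ : ∃ b, y = some b := by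
    rcases y with _ | b
    · exact absurd ((hadj none).2 (by simp)) G.irrefl
    · exact ⟨b, rfl⟩
  have hab : ¬ G.Adj (some a) (some b) := hna _ _ ((hadj _).2 (by simp)) ((hadj _).2 (by simp))
  have hne : a ≠ b := fun h => hxy (by rw [h])
  refine ⟨{ Adj := fun c d => G.Adj (some c) (some d) ∨ s(c, d) = s(a, b)
            symm := ⟨fun c d h => by rwa [G.adj_comm, Sym2.eq_swap]⟩
            loopless := ⟨fun c h => by
              rcases h with h | h
              · exact G.irrefl h
              · exact hne (by simp at h; grind)⟩ }, s(a, b), Or.inr rfl, ?_⟩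
  ext (_ | c) (_ | d)
  · simp [subdivide]
  · simp [subdivide, hadj]
  · simp [subdivide, G.adj_comm _ none, hadj]
  · simp only [subdivide]
    constructor
    · rintro ⟨h | h, h'⟩
      · exact h
      · exact absurd h h'
    · intro h
      refine ⟨Or.inl h, fun h' => ?_⟩
      rcases Sym2.eq_iff.1 h' with ⟨rfl, rfl⟩ | ⟨rfl, rfl⟩
      · exact hab h
      · exact hab h.symm

theorem subdivide_not_adj {W : Type*} (G : SimpleGraph W) (e : Sym2 W)
    (u v : Option W) (hu : (subdivide G e).Adj none u) (hv : (subdivide G e).Adj none v) :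
    ¬ (subdivide G e).Adj u v := by
  rcases u with _ | u <;> rcases v with _ | v <;> simp only [subdivide] at *
  rintro ⟨h, h'⟩
  exact h' ((Sym2.mem_and_mem_iff h.ne).1 ⟨hu, hv⟩).symm

theorem subdivide_injective {W : Type*} {G H : SimpleGraph W} {e f : Sym2 W} (he : e ∈ G.edgeSet)
    (hf : f ∈ H.edgeSet) (h : subdivide G e = subdivide H f) : G = H ∧ e = f := by
  have hef : e = f := Sym2.ext fun a => by
    have : (subdivide G e).Adj none (some a) ↔ (subdivide H f).Adj none (some a) := by rw [h]
    exact this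
  subst hef
  refine ⟨?_, rfl⟩
  ext a b
  by_cases hs : s(a, b) = e
  · rw [← SimpleGraph.mem_edgeSet, ← SimpleGraph.mem_edgeSet, hs]; exact iff_of_true he hf
  · have : (subdivide G e).Adj (some a) (some b) ↔ (subdivide H e).Adj (some a) (some b) := by
      rw [h]
    simpa [subdivide, hs] using this

/-- The graphs in which `none` has degree two and non-adjacent neighbors are the edge
subdivisions. -/
theorem ncard_subdivisible {W : Type*} [Finite W] (p q : ℕ) :
    {G : SimpleGraph (Option W) | G ∈ connDegSet (Option W) p q ∧ vdeg G none = 2 ∧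
      ∀ u v, G.Adj none u → G.Adj none v → ¬ G.Adj u v}.ncard =
    (connDegSet W p q).ncard * ((2 * Nat.card W + q - p) / 2) := by
  rw [← ncard_prod_of_fst {z : SimpleGraph W × Sym2 W | z.1 ∈ connDegSet W p q ∧ z.2 ∈ z.1.edgeSet}
    (connDegSet W p q) _ (fun z hz => hz.1)]
  · symm
    refine Set.ncard_congr (fun z hz => subdivide z.1 z.2) ?_ ?_ ?_
    · intro z hz
      exact ⟨(subdivide_mem_connDegSet _ _ hz.2).2 hz.1, vdeg_subdivide_none _ _ hz.2,
        subdivide_not_adj _ _⟩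
    · intro z z' hz hz' h
      exact Prod.ext_iff.2 (subdivide_injective hz.2 hz'.2 h)
    · rintro G ⟨hG, h2, hna⟩
      obtain ⟨H, e, he, rfl⟩ := exists_eq_subdivide G h2 hna
      exact ⟨(H, e), ⟨(subdivide_mem_connDegSet _ _ he).1 hG, he⟩, rfl⟩
  · intro G hG
    have h1 := two_mul_ncard_edgeSet hG
    have h2 : {e | (G, e) ∈ {z : SimpleGraph W × Sym2 W | z.1 ∈ connDegSet W p q ∧
      z.2 ∈ z.1.edgeSet}} = G.edgeSet := by
      ext e; simp [hG]
    rw [h2]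
    lia

theorem ncard_subdivisible_at {n : ℕ} (p q : ℕ) (x : Fin (n + 1)) :
    {G : SimpleGraph (Fin (n + 1)) | G ∈ connDegSet (Fin (n + 1)) p q ∧ vdeg G x = 2 ∧
      ∀ u v, G.Adj x u → G.Adj x v → ¬ G.Adj u v}.ncard =
    (connDegSet (Fin n) p q).ncard * ((2 * n + q - p) / 2) := by
  have := ncard_subdivisible (W := Fin n) p q
  rw [Nat.card_fin] at this
  rw [← this]
  symm
  refine Set.ncard_congr (fun G _ => G.comap (finSuccEquiv' x)) ?_ ?_ ?_
  · rintro G ⟨h1, h2, h3⟩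
    let f : G.comap (finSuccEquiv' x) ≃g G := SimpleGraph.Iso.comap (finSuccEquiv' x) G
    have hx : f x = none := finSuccEquiv'_at x
    refine ⟨(mem_connDegSet_iso f).2 h1, by rw [← vdeg_iso f, hx, h2], fun u v hu hv huv => ?_⟩
    rw [← f.map_adj_iff, hx] at hu hv
    exact h3 _ _ hu hv (f.map_adj_iff.2 huv)
  · intro G H _ _ h
    exact (finSuccEquiv' x).symm.simpleGraph.injective h
  · rintro G ⟨h1, h2, h3⟩
    refine ⟨G.comap (finSuccEquiv' x).symm, ?_, (finSuccEquiv' x).symm.simpleGraph.apply_symm_apply G⟩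
    let f : G.comap (finSuccEquiv' x).symm ≃g G := SimpleGraph.Iso.comap (finSuccEquiv' x).symm G
    have hx : f none = x := by simp [f]
    refine ⟨(mem_connDegSet_iso f).2 h1, by rw [← vdeg_iso f, hx, h2], fun u v hu hv huv => ?_⟩
    rw [← f.map_adj_iff, hx] at hu hv
    exact h3 _ _ hu hv (f.map_adj_iff.2 huv)

/-- Join all pairs of distinct neighbors of `x` in `H`. -/
def joinNeighbors {V : Type*} (H : SimpleGraph V) (x : V) : SimpleGraph V where
  Adj a b := H.Adj a b ∨ (a ≠ b ∧ H.Adj x a ∧ H.Adj x b)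
  symm := ⟨fun a b h => by simpa [H.adj_comm, ne_comm, and_comm] using h⟩
  loopless := ⟨fun a h => by simp at h⟩

theorem vdeg_deleteEdge_left {V : Type*} [Finite V] {G : SimpleGraph V} {u v : V}
    (huv : G.Adj u v) : vdeg (G.deleteEdges {s(u, v)}) u + 1 = vdeg G u := by
  have : (G.deleteEdges {s(u, v)}).neighborSet u = G.neighborSet u \ {v} := by
    ext w
    simp only [SimpleGraph.mem_neighborSet, SimpleGraph.deleteEdges_adj, Set.mem_singleton_iff,
      Sym2.congr_right, Set.mem_sdiff]
  rw [vdeg, this, Set.ncard_sdiff_singleton_add_one (by simpa using huv), vdeg]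

theorem vdeg_deleteEdge_right {V : Type*} [Finite V] {G : SimpleGraph V} {u v : V}
    (huv : G.Adj u v) : vdeg (G.deleteEdges {s(u, v)}) v + 1 = vdeg G v := by
  rw [Sym2.eq_swap]
  exact vdeg_deleteEdge_left huv.symm

theorem vdeg_deleteEdge_of_ne {V : Type*} {G : SimpleGraph V} {u v w : V} (hu : w ≠ u)
    (hv : w ≠ v) : vdeg (G.deleteEdges {s(u, v)}) w = vdeg G w := by
  have : (G.deleteEdges {s(u, v)}).neighborSet w = G.neighborSet w := by
    ext z
    simp [hu, hv]
  rw [vdeg, this, vdeg]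

theorem neighborSet_eq_pair {V : Type*} {G : SimpleGraph V} {x u v : V}
    (hx : vdeg G x = 2) (hu : G.Adj x u) (hv : G.Adj x v) (huv : u ≠ v) :
    G.neighborSet x = {u, v} := by
  symm
  refine Set.eq_of_subset_of_ncard_le ?_ ?_ (Set.finite_of_ncard_pos (by rw [vdeg] at hx; lia))
  · simp [Set.insert_subset_iff, hu, hv]
  · rw [Set.ncard_pair huv, ← hx, vdeg]

theorem joinNeighbors_deleteEdge {V : Type*} {G : SimpleGraph V} {x u v : V}
    (hx : vdeg G x = 2) (hu : G.Adj x u) (hv : G.Adj x v) (huv : G.Adj u v) :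
    joinNeighbors (G.deleteEdges {s(u, v)}) x = G := by
  have hN := neighborSet_eq_pair hx hu hv huv.ne
  have hadj : ∀ z, (G.deleteEdges {s(u, v)}).Adj x z ↔ z = u ∨ z = v := fun z => by
    have : G.Adj x z ↔ z = u ∨ z = v := by rw [← SimpleGraph.mem_neighborSet, hN]; simp
    simp [this, hu.ne, hv.ne]
  ext a b
  simp only [joinNeighbors, hadj, SimpleGraph.deleteEdges_adj, Set.mem_singleton_iff, Sym2.eq_iff]
  have h1 := huv.symm
  have h2 : G.Adj a b → a ≠ b := fun h => h.ne
  grind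

theorem connected_deleteEdge_of_triangle {V : Type*} {G : SimpleGraph V} (hG : G.Connected)
    {x u v : V} (hu : G.Adj x u) (hv : G.Adj x v) :
    (G.deleteEdges {s(u, v)}).Connected := by
  have hu' : (G.deleteEdges {s(u, v)}).Adj x u := by simp [hu, hu.ne, hv.ne]
  have hv' : (G.deleteEdges {s(u, v)}).Adj x v := by simp [hv, hu.ne, hv.ne]
  refine hG.of_forall_adj_reachable id (fun a b hab => ?_) (fun w => ⟨w, by rfl⟩)
  by_cases hs : s(a, b) = s(u, v)
  · rcases Sym2.eq_iff.1 hs with ⟨rfl, rfl⟩ | ⟨rfl, rfl⟩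
    · exact hu'.symm.reachable.trans hv'.reachable
    · exact hv'.symm.reachable.trans hu'.reachable
  · exact SimpleGraph.Adj.reachable (by simpa [hab] using hs)

theorem card_le_three_of_isolated_triangle {V : Type*} {G : SimpleGraph V}
    (hG : G.Connected) {x u v : V} (hx : vdeg G x = 2) (h2u : vdeg G u = 2) (h2v : vdeg G v = 2)
    (hu : G.Adj x u) (hv : G.Adj x v) (huv : G.Adj u v) : Nat.card V ≤ 3 := by
  have hNx := neighborSet_eq_pair hx hu hv huv.ne
  have hNu := neighborSet_eq_pair h2u hu.symm huv hv.ne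
  have hNv := neighborSet_eq_pair h2v hv.symm huv.symm hu.ne
  have key : ∀ a b : V, G.Reachable a b → a ∈ ({x, u, v} : Set V) → b ∈ ({x, u, v} : Set V) := by
    rintro a b ⟨w⟩
    induction w with
    | nil => exact id
    | cons h _ ih =>
      intro ha
      apply ih
      rw [← SimpleGraph.mem_neighborSet] at h
      simp only [Set.mem_insert_iff, Set.mem_singleton_iff] at ha ⊢
      rcases ha with rfl | rfl | rfl <;> simp only [hNx, hNu, hNv, Set.mem_insert_iff,
        Set.mem_singleton_iff] at h <;> tauto
  have huniv : (Set.univ : Set V) = {x, u, v} :=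
    (Set.eq_univ_of_forall fun b => key x b (hG.preconnected x b) (by simp)).symm
  rw [← Set.ncard_univ, huniv]
  classical
  have := Finset.card_le_three (a := x) (b := u) (c := v)
  rw [← Set.ncard_coe_finset] at this
  simpa using this

theorem deleteEdge_mem_of_three_three {V : Type*} [Finite V] {G : SimpleGraph V} {p q : ℕ}
    (hG : G ∈ connDegSet V p q) {x u v : V} (h3u : vdeg G u = 3) (h3v : vdeg G v = 3)
    (hu : G.Adj x u) (hv : G.Adj x v) (huv : G.Adj u v) :
    2 ≤ q ∧ G.deleteEdges {s(u, v)} ∈ connDegSet V p (q - 2) := by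
  obtain ⟨hc, hd, rfl, rfl⟩ := hG
  have d1 := vdeg_deleteEdge_left huv
  have d2 := vdeg_deleteEdge_right huv
  have d3 : ∀ w, w = u ∨ w = v ∨ vdeg (G.deleteEdges {s(u, v)}) w = vdeg G w := fun w => by
    have := vdeg_deleteEdge_of_ne (G := G) (u := u) (v := v) (w := w)
    tauto
  have e1 : {w | vdeg (G.deleteEdges {s(u, v)}) w = 1} = {w | vdeg G w = 1} := by
    ext w
    simp only [Set.mem_ofPred_eq]
    grind
  have e3 : {w | vdeg (G.deleteEdges {s(u, v)}) w = 3} = {w | vdeg G w = 3} \ {u, v} := by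
    ext w
    simp only [Set.mem_ofPred_eq, Set.mem_sdiff, Set.mem_insert_iff, Set.mem_singleton_iff]
    grind
  have hsub : ({u, v} : Set V) ⊆ {w | vdeg G w = 3} := by
    rintro w (rfl | rfl) <;> simp [*]
  refine ⟨?_, connected_deleteEdge_of_triangle hc hu hv, fun w => ?_, by rw [e1], ?_⟩
  · rw [← Set.ncard_pair huv.ne]
    exact Set.ncard_le_ncard hsub
  · clear hsub e1 e3
    grind
  · rw [e3, Set.ncard_sdiff hsub, Set.ncard_pair huv.ne]

theorem deleteEdge_mem_of_two_three {V : Type*} [Finite V] {G : SimpleGraph V} {p q : ℕ}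
    (hG : G ∈ connDegSet V p q) {x u v : V} (h2u : vdeg G u = 2) (h3v : vdeg G v = 3)
    (hu : G.Adj x u) (hv : G.Adj x v) (huv : G.Adj u v) :
    1 ≤ q ∧ G.deleteEdges {s(u, v)} ∈ connDegSet V (p + 1) (q - 1) := by
  obtain ⟨hc, hd, rfl, rfl⟩ := hG
  have d1 := vdeg_deleteEdge_left huv
  have d2 := vdeg_deleteEdge_right huv
  have d3 : ∀ w, w = u ∨ w = v ∨ vdeg (G.deleteEdges {s(u, v)}) w = vdeg G w := fun w => by
    have := vdeg_deleteEdge_of_ne (G := G) (u := u) (v := v) (w := w)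
    tauto
  have e1 : {w | vdeg (G.deleteEdges {s(u, v)}) w = 1} = insert u {w | vdeg G w = 1} := by
    ext w
    simp only [Set.mem_ofPred_eq, Set.mem_insert_iff]
    grind
  have e3 : {w | vdeg (G.deleteEdges {s(u, v)}) w = 3} = {w | vdeg G w = 3} \ {v} := by
    ext w
    simp only [Set.mem_ofPred_eq, Set.mem_sdiff, Set.mem_singleton_iff]
    grind
  have hsub : ({v} : Set V) ⊆ {w | vdeg G w = 3} := by
    rintro w rfl; simp [*]
  refine ⟨?_, connected_deleteEdge_of_triangle hc hu hv, fun w => ?_, ?_, ?_⟩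
  · rw [← Set.ncard_singleton v]
    exact Set.ncard_le_ncard hsub
  · clear hsub e1 e3
    grind
  · rw [e1, Set.ncard_insert_of_notMem (by simp [h2u])]
  · rw [e3, Set.ncard_sdiff hsub, Set.ncard_singleton]

/-- The pairs of a graph in `connDegSet V p q` and a vertex of degree two lying in a triangle. -/
def triangleSet (V : Type*) (p q : ℕ) : Set (SimpleGraph V × V) :=
  {z | z.1 ∈ connDegSet V p q ∧ vdeg z.1 z.2 = 2 ∧
    ∃ u v, z.1.Adj z.2 u ∧ z.1.Adj z.2 v ∧ z.1.Adj u v}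

theorem exists_of_mem_triangleSet {V : Type*} [Finite V] (hV : 4 ≤ Nat.card V) {p q : ℕ}
    {G : SimpleGraph V} {x : V} (h : (G, x) ∈ triangleSet V p q) :
    (2 ≤ q ∧ ∃ H ∈ connDegSet V p (q - 2), joinNeighbors H x = G) ∨
    (1 ≤ q ∧ ∃ H ∈ connDegSet V (p + 1) (q - 1), ∃ w, vdeg H w = 1 ∧ H.Adj w x ∧
      joinNeighbors H x = G) := by
  obtain ⟨hG, hx, u, v, hu, hv, huv⟩ := h
  simp only at hG hx hu hv huv
  have hge : ∀ a b c, G.Adj a b → G.Adj a c → b ≠ c → vdeg G a = 2 ∨ vdeg G a = 3 := by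
    intro a b c hb hc hbc
    have : ({b, c} : Set V).ncard ≤ vdeg G a := Set.ncard_le_ncard (by
      simp [Set.insert_subset_iff, hb, hc])
    rw [Set.ncard_pair hbc] at this
    have := hG.2.1 a
    lia
  have key : ∀ u v, G.Adj x u → G.Adj x v → G.Adj u v → vdeg G u = 2 → vdeg G v = 3 →
    (1 ≤ q ∧ ∃ H ∈ connDegSet V (p + 1) (q - 1), ∃ w, vdeg H w = 1 ∧ H.Adj w x ∧
      joinNeighbors H x = G) := by
    intro u v hu hv huv h2 h3
    obtain ⟨h, h'⟩ := deleteEdge_mem_of_two_three hG h2 h3 hu hv huv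
    refine ⟨h, _, h', u, ?_, ?_, joinNeighbors_deleteEdge hx hu hv huv⟩
    · have := vdeg_deleteEdge_left huv
      lia
    · simp [hu.symm, hv.ne, huv.ne]
  rcases hge u x v hu.symm huv hv.ne with h1 | h1 <;>
    rcases hge v x u hv.symm huv.symm hu.ne with h2 | h2
  · have := card_le_three_of_isolated_triangle hG.1 hx h1 h2 hu hv huv
    lia
  · exact Or.inr (key u v hu hv huv h1 h2)
  · exact Or.inr (key v u hv hu huv.symm h2 h1)
  · obtain ⟨h, h'⟩ := deleteEdge_mem_of_three_three hG h1 h2 hu hv huv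
    exact Or.inl ⟨h, _, h', joinNeighbors_deleteEdge hx hu hv huv⟩

theorem ncard_triangleSet_le {V : Type*} [Finite V] (hV : 4 ≤ Nat.card V) (p q : ℕ) :
    (triangleSet V p q).ncard ≤
      (if 2 ≤ q then (connDegSet V p (q - 2)).ncard * Nat.card V else 0) +
      (if 1 ≤ q then (connDegSet V (p + 1) (q - 1)).ncard * (p + 1) else 0) := by
  classical
  let S₁ : Set (SimpleGraph V × V) := {z | 2 ≤ q ∧ z.1 ∈ connDegSet V p (q - 2)}
  let S₂ : Set (SimpleGraph V × V) :=
    {z | 1 ≤ q ∧ z.1 ∈ connDegSet V (p + 1) (q - 1) ∧ vdeg z.1 z.2 = 1}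
  let nb : SimpleGraph V × V → V := fun z => if h : ∃ x, z.1.Adj z.2 x then h.choose else z.2
  have hsub : triangleSet V p q ⊆ (fun z => (joinNeighbors z.1 z.2, z.2)) '' S₁ ∪
      (fun z => (joinNeighbors z.1 (nb z), nb z)) '' S₂ := by
    rintro ⟨G, x⟩ h
    rcases exists_of_mem_triangleSet hV h with ⟨hq, H, hH, rfl⟩ | ⟨hq, H, hH, w, hw, hx, rfl⟩
    · exact Or.inl ⟨(H, x), ⟨hq, hH⟩, rfl⟩
    · refine Or.inr ⟨(H, w), ⟨hq, hH, hw⟩, ?_⟩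
      obtain ⟨y, hy⟩ := Set.ncard_eq_one.1 hw
      have hnb : nb (H, w) ∈ H.neighborSet w := by
        simp only [nb, dif_pos (⟨x, hx⟩ : ∃ x, H.Adj w x), SimpleGraph.mem_neighborSet]
        exact Exists.choose_spec (⟨x, hx⟩ : ∃ x, H.Adj w x)
      have hx' : x ∈ H.neighborSet w := hx
      rw [hy, Set.mem_singleton_iff] at hnb hx'
      simp only [hnb, hx']
  refine (Set.ncard_le_ncard hsub).trans ((Set.ncard_union_le _ _).trans (add_le_add ?_ ?_)) <;>
    refine (Set.ncard_image_le).trans ?_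
  · split_ifs with h
    · refine (ncard_prod_of_fst S₁ _ _ (fun z hz => hz.2) fun a ha => ?_).le
      rw [← Set.ncard_univ]
      congr 1
      ext b
      simp [S₁, h, ha]
    · simp [S₁, h]
  · split_ifs with h
    · refine (ncard_prod_of_fst S₂ _ _ (fun z hz => hz.2.1) fun a ha => ?_).le
      rw [← ha.2.2.1]
      congr 1
      ext b
      simp [S₂, h, ha]
    · simp [S₂, h]

theorem ncard_connDegSet_recurrence {n s : ℕ} (p q : ℕ) (hs : s + p + q = n + 1) :
    (connDegSet (Fin (n + 1)) p q).ncard * s =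
      (n + 1) * ((connDegSet (Fin n) p q).ncard * ((2 * n + q - p) / 2)) +
        (triangleSet (Fin (n + 1)) p q).ncard := by
  let P : Set (SimpleGraph (Fin (n + 1)) × Fin (n + 1)) :=
    {z | z.1 ∈ connDegSet _ p q ∧ vdeg z.1 z.2 = 2}
  let P₀ : Set (SimpleGraph (Fin (n + 1)) × Fin (n + 1)) :=
    {z | z.1 ∈ connDegSet _ p q ∧ vdeg z.1 z.2 = 2 ∧
      ∀ u v, z.1.Adj z.2 u → z.1.Adj z.2 v → ¬ z.1.Adj u v}
  have h1 : P.ncard = (connDegSet (Fin (n + 1)) p q).ncard * s := by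
    refine ncard_prod_of_fst P _ _ (fun z hz => hz.1) fun a ha => ?_
    have := ncard_vdeg_two ha
    rw [Nat.card_fin] at this
    have h : {b | (a, b) ∈ P} = {v | vdeg a v = 2} := by
      ext b; simp [P, ha]
    rw [h]
    lia
  have h2 : P₀.ncard = (n + 1) * ((connDegSet (Fin n) p q).ncard * ((2 * n + q - p) / 2)) := by
    rw [ncard_prod_of_snd P₀ _ (fun x => ncard_subdivisible_at p q x), Nat.card_fin]
  rw [← h1, ← h2, ← Set.ncard_union_eq]
  · congr 1
    ext ⟨G, x⟩
    simp only [P, P₀, triangleSet, Set.mem_ofPred_eq, Set.mem_union]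
    grind
  · rw [Set.disjoint_left]
    rintro ⟨G, x⟩ ⟨_, _, h⟩ ⟨_, _, u, v, hu, hv, huv⟩
    exact h u v hu hv huv

/-- The exponential-generating-function coefficient attached to `connDegSet`. -/
noncomputable def connDegCoeff (p q n : ℕ) : ℝ :=
  ((connDegSet (Fin n) p q).ncard : ℝ) / n.factorial

theorem connDegCoeff_nonneg (p q n : ℕ) : 0 ≤ connDegCoeff p q n := by
  unfold connDegCoeff; positivity

theorem connDegCoeff_eq_zero_of_odd {p q : ℕ} (h : ¬ Even (p + q)) (n : ℕ) :
    connDegCoeff p q n = 0 := by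
  have : connDegSet (Fin n) p q = ∅ := by
    refine Set.eq_empty_of_forall_notMem fun G hG => h ?_
    have := two_mul_ncard_edgeSet hG
    rw [Nat.even_iff]
    lia
  simp [connDegCoeff, this]

theorem connDegCoeff_eq_zero_of_lt {p q n : ℕ} (h : n < p + q) : connDegCoeff p q n = 0 := by
  have : connDegSet (Fin n) p q = ∅ := by
    refine Set.eq_empty_of_forall_notMem fun G hG => ?_
    have := ncard_vdeg_two hG
    rw [Nat.card_fin] at this
    lia
  simp [connDegCoeff, this]

theorem connDegCoeff_succ {p q s : ℕ} (h : Even (p + q)) :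
    connDegCoeff p q (s + 1 + p + q) * (s + 1) =
      connDegCoeff p q (s + p + q) * (s + (p + 3 * q) / 2 : ℕ) +
      (triangleSet (Fin (s + 1 + p + q)) p q).ncard / (s + 1 + p + q).factorial := by
  have hn : s + 1 + p + q = (s + p + q) + 1 := by ring
  have key := ncard_connDegSet_recurrence p q hn
  have hE : (2 * (s + p + q) + q - p) / 2 = s + (p + 3 * q) / 2 := by
    rw [Nat.even_iff] at h
    lia
  rw [hE] at key
  have key' := congrArg (Nat.cast : ℕ → ℝ) key
  rw [hn]
  simp only [connDegCoeff, Nat.factorial_succ]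
  push_cast at key' ⊢
  have h1 : ((s + p + q).factorial : ℝ) ≠ 0 := by positivity
  have h2 : ((s : ℝ) + p + q + 1) ≠ 0 := by positivity
  field_simp
  linear_combination key'

theorem triangleSet_div_le {p q n : ℕ} (hn : 4 ≤ n) :
    ((triangleSet (Fin n) p q).ncard : ℝ) / n.factorial ≤
      (if 2 ≤ q then connDegCoeff p (q - 2) n * n else 0) +
      (if 1 ≤ q then connDegCoeff (p + 1) (q - 1) n * (p + 1) else 0) := by
  have h := ncard_triangleSet_le (V := Fin n) (by simpa using hn) p q
  rw [Nat.card_fin] at h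
  have h' : ((triangleSet (Fin n) p q).ncard : ℝ) ≤ _ := Nat.cast_le.2 h
  rw [div_le_iff₀ (by positivity)]
  refine h'.trans_eq ?_
  have h1 : ((n).factorial : ℝ) ≠ 0 := by positivity
  simp only [connDegCoeff]
  split_ifs <;> push_cast <;> field_simp <;> ring

theorem choose_add_succ_mul (s D : ℕ) :
    ((s + 1 + D).choose D : ℝ) * (s + 1) = (s + D).choose D * (s + D + 1) := by
  have := Nat.choose_mul_succ_eq (s + D) D
  rw [show s + D + 1 - D = s + 1 by lia, show s + D + 1 = s + 1 + D by lia] at this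
  have := congrArg (Nat.cast : ℕ → ℝ) this
  push_cast at this
  linear_combination -this

theorem add_one_pow_le_choose (s D : ℕ) :
    ((s : ℝ) + 1) ^ D ≤ D.factorial * (s + D).choose D := by
  have := Nat.pow_le_choose (α := ℝ) D (s + D)
  rw [show s + D + 1 - D = s + 1 by lia, div_le_iff₀ (by positivity)] at this
  push_cast at this
  linarith

theorem exists_forall_le_of_succ_le {D : ℕ} {f : ℕ → ℝ} (hf : ∀ s, 0 ≤ f s) {C : ℝ} (hC : 0 ≤ C)
    (s₀ : ℕ) (h : ∀ s ≥ s₀, f (s + 1) * (s + 1) ≤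
      f s * (s + D + 1) + C * (s + 1 : ℝ) ^ D / (s + 1)) :
    ∃ K, 0 ≤ K ∧ ∀ s, f s ≤ K * (s + 1 : ℝ) ^ D := by
  set m : ℕ → ℝ := fun s => (s + D).choose D with hm
  have mpos : ∀ s, 0 < m s := fun s => by
    simp only [hm]; exact_mod_cast Nat.choose_pos (by lia)
  set B := 2 * C * D.factorial with hB
  have hB0 : 0 ≤ B := by positivity
  have step : ∀ s ≥ s₀, f (s + 1) / m (s + 1) + B / (s + 2) ≤ f s / m s + B / (s + 1) := by
    intro s hs
    have h1 := h s hs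
    have h2 : m (s + 1) * (s + 1) = m s * (s + D + 1) := choose_add_succ_mul s D
    have h3 : (s + 1 : ℝ) ^ D ≤ D.factorial * m (s + 1) := by
      refine le_trans ?_ (add_one_pow_le_choose (s + 1) D)
      gcongr
      linarith
    have hp := mpos (s + 1)
    have hp' := mpos s
    have h4 : f (s + 1) / m (s + 1) ≤ f s / m s + C * D.factorial / (s + 1) ^ 2 := by
      have e : f (s + 1) * (s + 1) ≤ f s * (s + D + 1) + C * (D.factorial * m (s + 1)) / (s + 1) :=
        h1.trans (by gcongr)
      have e2 : f s / m s = f s * (s + D + 1) / (m (s + 1) * (s + 1)) := by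
        rw [h2]; field_simp
      have e3 : f s / m s + C * D.factorial / (s + 1) ^ 2 =
          (f s * (s + D + 1) + C * (D.factorial * m (s + 1)) / (s + 1)) /
            (m (s + 1) * (s + 1)) := by
        rw [e2]; field_simp
      rw [e3, le_div_iff₀ (by positivity)]
      refine le_trans (le_of_eq ?_) e
      field_simp
    have h5 : C * D.factorial / (s + 1 : ℝ) ^ 2 + B / (s + 2) ≤ B / (s + 1) := by
      rw [div_add_div _ _ (by positivity) (by positivity), div_le_div_iff₀ (by positivity)
        (by positivity), hB, ← sub_nonneg]
      have : 2 * C * D.factorial * ((s + 1 : ℝ) ^ 2 * (s + 2)) -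
        (C * D.factorial * (s + 2) + (s + 1) ^ 2 * (2 * C * D.factorial)) * (s + 1) =
        C * D.factorial * s * (s + 1) := by ring
      rw [this]
      positivity
    linarith
  have bound : ∀ s ≥ s₀, f s / m s + B / (s + 1) ≤ f s₀ / m s₀ + B / (s₀ + 1) := by
    intro s hs
    induction s, hs using Nat.le_induction with
    | base => rfl
    | succ s hs ih =>
      refine le_trans ?_ ((step s hs).trans ih)
      push_cast
      rw [add_assoc, one_add_one_eq_two]
  have hK0 : 0 ≤ f s₀ / m s₀ + B / (s₀ + 1) :=
    add_nonneg (div_nonneg (hf _) (mpos _).le) (by positivity)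
  have hS0 : 0 ≤ ∑ i ∈ Finset.range s₀, f i := Finset.sum_nonneg fun i _ => hf i
  refine ⟨(f s₀ / m s₀ + B / (s₀ + 1)) + ∑ i ∈ Finset.range s₀, f i, add_nonneg hK0 hS0,
    fun s => ?_⟩
  have hone : (1 : ℝ) ≤ (s + 1 : ℝ) ^ D := one_le_pow₀ (by linarith [(Nat.cast_nonneg s : (0 : ℝ) ≤ s)])
  rcases lt_or_ge s s₀ with hs | hs
  · have h1 : f s ≤ ∑ i ∈ Finset.range s₀, f i :=
      Finset.single_le_sum (fun i _ => hf i) (Finset.mem_range.2 hs)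
    nlinarith
  · have h1 : f s / m s ≤ f s₀ / m s₀ + B / (s₀ + 1) := by
      have := bound s hs
      have : 0 ≤ B / ((s : ℝ) + 1) := by positivity
      linarith
    rw [div_le_iff₀ (mpos s)] at h1
    have h2 : m s ≤ (s + 1 : ℝ) ^ D := by
      have := Nat.choose_add_le_add_one_pow s D
      simp only [hm]; exact_mod_cast this
    calc f s ≤ _ := h1
      _ ≤ (f s₀ / m s₀ + B / (s₀ + 1)) * (s + 1 : ℝ) ^ D := by gcongr
      _ ≤ _ := mul_le_mul_of_nonneg_right (by linarith) (by positivity)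

theorem exists_connDegCoeff_le (q : ℕ) : ∀ p, ∃ K, 0 ≤ K ∧
    ∀ n, connDegCoeff p q n ≤ K * (n + 1 : ℝ) ^ ((p + 3 * q) / 2 - 1) := by
  induction q using Nat.strong_induction_on with | _ q ih
  intro p
  by_cases hpar : Even (p + q)
  swap
  · exact ⟨0, le_rfl, fun n => by simp [connDegCoeff_eq_zero_of_odd hpar]⟩
  obtain ⟨K₁, hK₁, h₁⟩ : ∃ K, 0 ≤ K ∧ ∀ n, (if 2 ≤ q then connDegCoeff p (q - 2) n * n else 0) ≤
      K * (n + 1 : ℝ) ^ ((p + 3 * q) / 2 - 1 - 1) := by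
    by_cases hq : 2 ≤ q
    · obtain ⟨K, hK, h⟩ := ih (q - 2) (by lia) p
      refine ⟨K, hK, fun n => ?_⟩
      rw [if_pos hq]
      calc connDegCoeff p (q - 2) n * n
          ≤ (K * (n + 1 : ℝ) ^ ((p + 3 * (q - 2)) / 2 - 1)) * (n + 1) := by
            gcongr
            · exact h n
            · linarith
        _ = K * (n + 1 : ℝ) ^ ((p + 3 * (q - 2)) / 2 - 1 + 1) := by ring
        _ ≤ _ := by
            gcongr
            · linarith [(Nat.cast_nonneg n : (0 : ℝ) ≤ n)]
            · lia
    · exact ⟨0, le_rfl, fun n => by simp [hq]⟩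
  obtain ⟨K₂, hK₂, h₂⟩ : ∃ K, 0 ≤ K ∧
      ∀ n, (if 1 ≤ q then connDegCoeff (p + 1) (q - 1) n * (p + 1) else 0) ≤
      K * (n + 1 : ℝ) ^ ((p + 3 * q) / 2 - 1 - 1) := by
    by_cases hq : 1 ≤ q
    · obtain ⟨K, hK, h⟩ := ih (q - 1) (by lia) (p + 1)
      refine ⟨K * (p + 1), by positivity, fun n => ?_⟩
      rw [if_pos hq, mul_right_comm]
      gcongr
      refine (h n).trans_eq ?_
      congr 2
      rw [Nat.even_iff] at hpar
      lia
    · exact ⟨0, le_rfl, fun n => by simp [hq]⟩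
  set D := (p + 3 * q) / 2 - 1 with hD
  set L : ℝ := p + q + 2 with hL
  have hL0 : 0 < L := by positivity
  obtain ⟨K, hK, h⟩ := exists_forall_le_of_succ_le (D := D)
    (f := fun s => connDegCoeff p q (s + p + q)) (fun s => connDegCoeff_nonneg _ _ _)
    (C := (K₁ + K₂) * L ^ D) (by positivity) 3 fun s hs => by
      rw [connDegCoeff_succ hpar]
      refine add_le_add ?_ ?_
      · refine mul_le_mul_of_nonneg_left ?_ (connDegCoeff_nonneg _ _ _)
        have : s + (p + 3 * q) / 2 ≤ s + D + 1 := by lia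
        exact_mod_cast this
      · refine (triangleSet_div_le (by lia)).trans ?_
        by_cases hq : q = 0
        · rw [if_neg (by lia), if_neg (by lia), add_zero]
          positivity
        · refine (add_le_add (h₁ _) (h₂ _)).trans ?_
          have hD1 : D = (D - 1) + 1 := by
            rw [Nat.even_iff] at hpar
            lia
          have hs1 : (0 : ℝ) < s + 1 := by positivity
          rw [← add_mul]
          calc _ ≤ (K₁ + K₂) * (L * (s + 1)) ^ (D - 1) := by
                gcongr
                rw [hL]; push_cast
                have : (0 : ℝ) ≤ (p + q + 1) * s := by positivity
                linarith
            _ = (K₁ + K₂) * L ^ (D - 1) * (s + 1 : ℝ) ^ D / (s + 1) := by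
                conv_rhs => rw [hD1]
                rw [Nat.add_sub_cancel, pow_succ (s + 1 : ℝ)]
                rw [mul_pow]
                field_simp
            _ ≤ _ := by
                gcongr
                · rw [hL]
                  have : (0 : ℝ) ≤ p + q := by positivity
                  linarith
                · lia
  refine ⟨K, hK, fun n => ?_⟩
  rcases lt_or_ge n (p + q) with hn | hn
  · rw [connDegCoeff_eq_zero_of_lt hn]; positivity
  · obtain ⟨s, rfl⟩ := Nat.exists_eq_add_of_le hn
    have := h s
    rw [show p + q + s = s + p + q by ring]
    refine this.trans ?_
    gcongr
    linarith [(Nat.cast_nonneg p : (0 : ℝ) ≤ p), (Nat.cast_nonneg q : (0 : ℝ) ≤ q)]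

/-- The cycle on `4 * r` vertices together with the chords `{4 k, 4 k + 2}`. -/
def chordedCycle (r : ℕ) : SimpleGraph (Fin (4 * r)) :=
  SimpleGraph.fromRel fun i j => i.val + 1 = j.val ∨ (i.val = 0 ∧ j.val + 1 = 4 * r) ∨
    (i.val % 4 = 0 ∧ i.val + 2 = j.val)

theorem chordedCycle_adj {r : ℕ} (i j : Fin (4 * r)) : (chordedCycle r).Adj i j ↔
    (i.val + 1 = j.val ∨ (i.val = 0 ∧ j.val + 1 = 4 * r) ∨ (i.val % 4 = 0 ∧ i.val + 2 = j.val)) ∨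
    (j.val + 1 = i.val ∨ (j.val = 0 ∧ i.val + 1 = 4 * r) ∨
      (j.val % 4 = 0 ∧ j.val + 2 = i.val)) := by
  simp only [chordedCycle, SimpleGraph.fromRel_adj, ne_eq, Fin.ext_iff]
  lia

theorem vdeg_chordedCycle {r : ℕ} (i : Fin (4 * r)) :
    vdeg (chordedCycle r) i = if i.val % 2 = 0 then 3 else 2 := by
  have hi := i.isLt
  split_ifs with h
  · by_cases h4 : i.val % 4 = 0
    · have hN : (chordedCycle r).neighborSet i =
          {⟨if i.val = 0 then 4 * r - 1 else i.val - 1, by split_ifs <;> lia⟩,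
            ⟨i.val + 1, by lia⟩, ⟨i.val + 2, by lia⟩} := by
        ext j
        have hj := j.isLt
        simp only [SimpleGraph.mem_neighborSet, chordedCycle_adj, Set.mem_insert_iff,
          Set.mem_singleton_iff, Fin.ext_iff]
        split_ifs <;> lia
      rw [vdeg, Set.ncard_eq_three]
      refine ⟨_, _, _, ?_, ?_, ?_, hN⟩ <;> simp only [ne_eq, Fin.ext_iff] <;>
        (try split_ifs) <;> lia
    · have hN : (chordedCycle r).neighborSet i =
          {⟨i.val - 1, by lia⟩, ⟨i.val + 1, by lia⟩, ⟨i.val - 2, by lia⟩} := by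
        ext j
        have hj := j.isLt
        simp only [SimpleGraph.mem_neighborSet, chordedCycle_adj, Set.mem_insert_iff,
          Set.mem_singleton_iff, Fin.ext_iff]
        lia
      rw [vdeg, Set.ncard_eq_three]
      refine ⟨_, _, _, ?_, ?_, ?_, hN⟩ <;> simp only [ne_eq, Fin.ext_iff] <;> lia
  · have hN : (chordedCycle r).neighborSet i =
        {⟨i.val - 1, by lia⟩, ⟨if i.val + 1 = 4 * r then 0 else i.val + 1, by
          split_ifs <;> lia⟩} := by
      ext j
      have hj := j.isLt
      simp only [SimpleGraph.mem_neighborSet, chordedCycle_adj, Set.mem_insert_iff,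
        Set.mem_singleton_iff, Fin.ext_iff]
      split_ifs <;> lia
    rw [vdeg, Set.ncard_eq_two]
    refine ⟨_, _, ?_, hN⟩
    simp only [ne_eq, Fin.ext_iff]
    split_ifs <;> lia

theorem chordedCycle_connected {r : ℕ} (hr : 1 ≤ r) : (chordedCycle r).Connected := by
  have hpos : 0 < 4 * r := by lia
  have key : ∀ k (hk : k < 4 * r), (chordedCycle r).Reachable ⟨0, hpos⟩ ⟨k, hk⟩ := by
    intro k
    induction k with
    | zero => intro _; rfl
    | succ k ih =>
      intro hk
      refine (ih (by lia)).trans (SimpleGraph.Adj.reachable ?_)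
      simp [chordedCycle_adj]
  have : Nonempty (Fin (4 * r)) := ⟨⟨0, hpos⟩⟩
  exact ⟨fun a b => (key a a.isLt).symm.trans (key b b.isLt)⟩

theorem chordedCycle_mem {r : ℕ} (hr : 1 ≤ r) :
    chordedCycle r ∈ connDegSet (Fin (4 * r)) 0 (2 * r) := by
  refine ⟨chordedCycle_connected hr, fun v => ?_, ?_, ?_⟩
  · rw [vdeg_chordedCycle]
    split_ifs <;> lia
  · have : {v | vdeg (chordedCycle r) v = 1} = ∅ := by
      ext v
      simp only [vdeg_chordedCycle, Set.mem_ofPred_eq, Set.mem_empty_iff_false, iff_false]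
      split_ifs <;> lia
    rw [this, Set.ncard_empty]
  · have : {v | vdeg (chordedCycle r) v = 3} =
        Set.range fun k : Fin (2 * r) => (⟨2 * k.val, by lia⟩ : Fin (4 * r)) := by
      ext v
      simp only [vdeg_chordedCycle, Set.mem_ofPred_eq, Set.mem_range, Fin.ext_iff]
      constructor
      · intro h
        have hv := v.isLt
        exact ⟨⟨v.val / 2, by lia⟩, by split_ifs at h <;> lia⟩
      · rintro ⟨k, hk⟩
        rw [if_pos (by lia)]
    rw [this, ← Set.image_univ, Set.ncard_image_of_injective, Set.ncard_univ, Nat.card_fin]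
    intro a b hab
    simp only [Fin.mk.injEq] at hab
    ext
    lia

theorem Nconn_eq_ncard_connDegSet (r n : ℕ) :
    Nconn r n = (connDegSet (Fin n) 0 (2 * r)).ncard := by
  rw [Nconn, ← Nat.card_coe_set_eq]
  refine Nat.card_congr (Equiv.subtypeEquivRight fun G => ?_)
  constructor
  · rintro ⟨hc, he, hd⟩
    have hd' : ∀ v, vdeg G v = 1 ∨ vdeg G v = 2 ∨ vdeg G v = 3 := fun v => Or.inr (hd v)
    have h1 : {v | vdeg G v = 1}.ncard = 0 := by
      rw [Set.ncard_eq_zero]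
      ext v
      have := hd v
      simp only [Set.mem_ofPred_eq, Set.mem_empty_iff_false, iff_false]
      lia
    have hmem : G ∈ connDegSet (Fin n) 0 {v | vdeg G v = 3}.ncard := ⟨hc, hd', h1, rfl⟩
    have := two_mul_ncard_edgeSet hmem
    rw [Nat.card_fin] at this
    exact ⟨hc, hd', h1, by lia⟩
  · intro hG
    have h2 := two_mul_ncard_edgeSet hG
    rw [Nat.card_fin] at h2
    obtain ⟨hc, hd, h1, -⟩ := hG
    rw [Set.ncard_eq_zero] at h1
    refine ⟨hc, by lia, fun v => (hd v).resolve_left fun h => ?_⟩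
    have : v ∈ ({v | vdeg G v = 1} : Set (Fin n)) := h
    rw [h1] at this
    exact this

theorem tendsto_choose_div_pow (D a : ℕ) :
    Tendsto (fun s : ℕ => D.factorial * ((s + D).choose D : ℝ) / ((s + a : ℕ) : ℝ) ^ D) atTop
      (nhds 1) := by
  have lim : ∀ b : ℝ, Tendsto (fun s : ℕ => ((s + b) / (s + a) : ℝ) ^ D) atTop (nhds 1) := by
    intro b
    have := (tendsto_add_mul_div_add_mul_atTop_nhds (𝕜 := ℝ) b a 1 one_ne_zero).pow D
    simpa [add_comm] using this
  refine tendsto_of_tendsto_of_tendsto_of_le_of_le (lim 1) (lim D) (fun s => ?_) (fun s => ?_)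
  · simp only [div_pow]
    push_cast
    gcongr
    exact add_one_pow_le_choose s D
  · simp only [div_pow]
    push_cast
    gcongr
    have := Nat.choose_le_pow_div (α := ℝ) D (s + D)
    rw [le_div_iff₀ (by positivity)] at this
    push_cast at this
    linarith

theorem exists_tendsto_connDegCoeff_div {r : ℕ} (hr : 1 ≤ r) : ∃ c : ℝ, 0 < c ∧
    Tendsto (fun s : ℕ => connDegCoeff 0 (2 * r) (s + 2 * r) /
      (s + (3 * r - 1)).choose (3 * r - 1)) atTop (nhds c) := by
  set D := 3 * r - 1 with hD
  set g : ℕ → ℝ := fun s => connDegCoeff 0 (2 * r) (s + 2 * r) / (s + D).choose D with hg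
  have mpos : ∀ s : ℕ, (0 : ℝ) < (s + D).choose D := fun s => by
    exact_mod_cast Nat.choose_pos (by lia)
  have hmono : Monotone g := by
    refine monotone_nat_of_le_succ fun s => ?_
    have h := connDegCoeff_succ (p := 0) (q := 2 * r) (s := s) (by simp)
    have hT : (0 : ℝ) ≤ (triangleSet (Fin (s + 1 + 0 + 2 * r)) 0 (2 * r)).ncard /
      (s + 1 + 0 + 2 * r).factorial := by positivity
    have hE : s + (0 + 3 * (2 * r)) / 2 = s + D + 1 := by lia
    have hle : connDegCoeff 0 (2 * r) (s + 2 * r) * (s + D + 1) ≤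
        connDegCoeff 0 (2 * r) (s + 1 + 2 * r) * (s + 1) := by
      rw [hE] at h
      push_cast [add_zero] at h hT
      linarith
    have hm := choose_add_succ_mul s D
    simp only [hg]
    rw [div_le_div_iff₀ (mpos s) (mpos (s + 1))]
    refine le_of_mul_le_mul_right ?_ (show (0 : ℝ) < s + 1 by positivity)
    calc _ = connDegCoeff 0 (2 * r) (s + 2 * r) * (s + D + 1) * (s + D).choose D := by
          rw [mul_assoc, hm]; ring
      _ ≤ connDegCoeff 0 (2 * r) (s + 1 + 2 * r) * (s + 1) * (s + D).choose D :=
          mul_le_mul_of_nonneg_right hle (mpos s).le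
      _ = _ := by ring
  have hbdd : BddAbove (Set.range g) := by
    obtain ⟨K, hK, h⟩ := exists_connDegCoeff_le (2 * r) 0
    have hD' : (0 + 3 * (2 * r)) / 2 - 1 = D := by lia
    rw [hD'] at h
    refine ⟨K * (2 * r + 1) ^ D * D.factorial, ?_⟩
    rintro _ ⟨s, rfl⟩
    simp only [hg]
    rw [div_le_iff₀ (mpos s)]
    calc _ ≤ _ := h _
      _ ≤ K * ((2 * r + 1) * (s + 1) : ℝ) ^ D := by
          gcongr
          push_cast
          have : (0 : ℝ) ≤ 2 * r * s := by positivity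
          linarith
      _ = K * (2 * r + 1) ^ D * (s + 1 : ℝ) ^ D := by rw [mul_pow]; ring
      _ ≤ K * (2 * r + 1) ^ D * (D.factorial * (s + D).choose D) := by
          gcongr
          exact add_one_pow_le_choose s D
      _ = _ := by ring
  refine ⟨⨆ s, g s, ?_, tendsto_atTop_ciSup hmono hbdd⟩
  refine lt_of_lt_of_le ?_ (le_ciSup hbdd (2 * r))
  refine div_pos ?_ (mpos _)
  rw [← two_mul, ← mul_assoc]
  refine div_pos ?_ (by positivity)
  exact_mod_cast (Set.ncard_pos).2 ⟨_, chordedCycle_mem hr⟩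

theorem count_connected_cubic_kernel (r : ℕ) (hr : 1 ≤ r) :
    ∃ c : ℝ, 0 < c ∧
      Tendsto
        (fun n : ℕ =>
          (Nconn r n : ℝ) /
            ((n.factorial : ℝ) * (n : ℝ) ^ (3 * r - 1) / ((3 * r - 1).factorial : ℝ)))
        atTop (nhds c) := by
  obtain ⟨c, hc, h⟩ := exists_tendsto_connDegCoeff_div hr
  refine ⟨c, hc, (tendsto_add_atTop_iff_nat (2 * r)).1 ?_⟩
  have := h.mul (tendsto_choose_div_pow (3 * r - 1) (2 * r))
  rw [mul_one] at this
  refine this.congr fun s => ?_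
  have h1 : ((s + (3 * r - 1)).choose (3 * r - 1) : ℝ) ≠ 0 := by
    exact_mod_cast (Nat.choose_pos (by lia)).ne'
  rw [Nconn_eq_ncard_connDegSet, connDegCoeff]
  field_simp
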